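/- arXiv:1404.4583 — 4 statements merged into one kernel-verified Lean document; each statement's English description precedes it below -/
import Mathlib

section
/- Suppose m_1, …, m_n are nonnegative integers. Then lim_{r→∞} (1/r^{4/n}) log( ∏_{k=1}^∞ p_k^{ℍ}(r) ) = −n/8. In particular the leading-order decay of the hole probability of the generalised induced infinite quaternion Ginibre ensemble depends only on the number n of matrices multiplied. -/
open MeasureTheory Real Filter

/-- The density at `x > 0` of the Gamma distribution with shape `N + 1` and rate `1`. -/
noncomputable def erlangDensity (N : ℕ) (x : ℝ) : ℝ := x ^ N * exp (-x) / N.factorial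

/-- The probability that a Poisson variable with mean `R` is at most `N`. -/
noncomputable def poissonLowerTail (N : ℕ) (R : ℝ) : ℝ :=
  exp (-R) * ∑ j ∈ Finset.range (N + 1), R ^ j / j.factorial

/-- The probability that a product of independent Gamma variables of shapes `N a + 1` and rate `1`
exceeds `r ^ 2`. -/
noncomputable def erlangProductTail {n : ℕ} (N : Fin n → ℕ) (r : ℝ) : ℝ :=
  ∫ x : Fin n → ℝ in {x | (∀ a, 0 < x a) ∧ r ^ 2 < ∏ a, x a}, ∏ a, erlangDensity (N a) (x a)

lemma erlangDensity_nonneg (N : ℕ) {x : ℝ} (hx : 0 ≤ x) : 0 ≤ erlangDensity N x := by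
  unfold erlangDensity; positivity

lemma poissonLowerTail_zero_right (N : ℕ) : poissonLowerTail N 0 = 1 := by
  simp [poissonLowerTail, Finset.sum_range_succ']

lemma hasDerivAt_poissonLowerTail (N : ℕ) (x : ℝ) :
    HasDerivAt (poissonLowerTail N) (-erlangDensity N x) x := by
  have hexp : HasDerivAt (fun y : ℝ => exp (-y)) (-exp (-x)) x := by
    simpa using (hasDerivAt_neg x).exp
  induction N with
  | zero =>
    have : poissonLowerTail 0 = fun y => exp (-y) := by
      ext y; simp [poissonLowerTail]
    rw [this]
    simpa [erlangDensity] using hexp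
  | succ N ih =>
    have h : poissonLowerTail (N + 1) =
        fun y => poissonLowerTail N y + exp (-y) * (y ^ (N + 1) / (N + 1).factorial) := by
      ext y
      simp only [poissonLowerTail]
      rw [Finset.sum_range_succ _ (N + 1), mul_add]
    rw [h]
    refine (ih.add (hexp.mul ((hasDerivAt_pow (N + 1) x).div_const _))).congr_deriv ?_
    have : (N.factorial : ℝ) ≠ 0 := by positivity
    simp only [erlangDensity, Nat.factorial_succ]
    push_cast
    field_simp
    simp

lemma tendsto_poissonLowerTail (N : ℕ) : Tendsto (poissonLowerTail N) atTop (nhds 0) := by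
  have h : poissonLowerTail N = fun R => ∑ j ∈ Finset.range (N + 1),
      (R ^ j * exp (-R)) / j.factorial := by
    ext R
    rw [poissonLowerTail, Finset.mul_sum]
    exact Finset.sum_congr rfl fun j _ => by ring
  rw [h]
  have := tendsto_finsetSum (f := fun (j : ℕ) (R : ℝ) => (R ^ j * exp (-R)) / j.factorial)
    (Finset.range (N + 1))
    fun j _ => (tendsto_pow_mul_exp_neg_atTop_nhds_zero j).div_const (j.factorial : ℝ)
  simpa using this

lemma erlang_tail (N : ℕ) {R : ℝ} (hR : 0 ≤ R) :
    IntegrableOn (erlangDensity N) (Set.Ioi R) ∧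
      ∫ x in Set.Ioi R, erlangDensity N x = poissonLowerTail N R := by
  have hd : ∀ x ∈ Set.Ici R, HasDerivAt (fun y => -poissonLowerTail N y) (erlangDensity N x) x :=
    fun x _ => by
      have h := (hasDerivAt_poissonLowerTail N x).neg
      rw [neg_neg] at h
      exact h
  have hn : ∀ x ∈ Set.Ioi R, 0 ≤ erlangDensity N x :=
    fun x hx => erlangDensity_nonneg N (hR.trans (le_of_lt hx))
  have ht : Tendsto (fun y => -poissonLowerTail N y) atTop (nhds 0) := by
    simpa using (tendsto_poissonLowerTail N).neg
  refine ⟨integrableOn_Ioi_deriv_of_nonneg' hd hn ht, ?_⟩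
  simpa using integral_Ioi_of_hasDerivAt_of_nonneg' hd hn ht

lemma prod_erlangDensity_orthant {n : ℕ} (N : Fin n → ℕ) {R : ℝ} (hR : 0 ≤ R) :
    IntegrableOn (fun x : Fin n → ℝ => ∏ a, erlangDensity (N a) (x a))
        (Set.univ.pi fun _ => Set.Ioi R) ∧
      ∫ x : Fin n → ℝ in Set.univ.pi fun _ => Set.Ioi R, ∏ a, erlangDensity (N a) (x a) =
        ∏ a, poissonLowerTail (N a) R := by
  rw [IntegrableOn, volume_pi, Measure.restrict_pi_pi]
  refine ⟨Integrable.fintype_prod fun a => (erlang_tail (N a) hR).1, ?_⟩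
  rw [integral_fintype_prod_eq_prod]
  exact Finset.prod_congr rfl fun a _ => (erlang_tail (N a) hR).2

lemma prod_poissonLowerTail_le_erlangProductTail {n : ℕ} (hn : 1 ≤ n) (N : Fin n → ℕ) {R r : ℝ}
    (hR : 0 < R) (hRr : R ^ n = r ^ 2) :
    ∏ a, poissonLowerTail (N a) R ≤ erlangProductTail N r := by
  rw [← (prod_erlangDensity_orthant N hR.le).2]
  have hmeas : MeasurableSet {x : Fin n → ℝ | (∀ a, 0 < x a) ∧ r ^ 2 < ∏ a, x a} := by
    measurability
  refine setIntegral_mono_set ?_ ?_ (LE.le.eventuallyLE ?_)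
  · refine (prod_erlangDensity_orthant N le_rfl).1.mono_set fun x hx => ?_
    simpa using hx.1
  · refine (ae_restrict_mem hmeas).mono fun x hx => ?_
    exact Finset.prod_nonneg fun a _ => erlangDensity_nonneg _ (hx.1 a).le
  · intro x hx
    have hx' : ∀ a, R < x a := by simpa using hx
    refine ⟨fun a => hR.trans (hx' a), ?_⟩
    have : Nonempty (Fin n) := ⟨⟨0, hn⟩⟩
    calc r ^ 2 = ∏ _a : Fin n, R := by simp [hRr]
      _ < ∏ a, x a := Finset.prod_lt_prod_of_nonempty (fun _ _ => hR) (fun a _ => hx' a)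
        Finset.univ_nonempty

lemma erlangProductTail_mul_le {n : ℕ} (N : Fin n → ℕ) (s : ℕ) (r : ℝ) :
    erlangProductTail N r * (r ^ 2) ^ s ≤
      ∏ a, (((N a + s).factorial : ℝ) / (N a).factorial) := by
  have hmeas : MeasurableSet {x : Fin n → ℝ | (∀ a, 0 < x a) ∧ r ^ 2 < ∏ a, x a} := by
    measurability
  have hsub : {x : Fin n → ℝ | (∀ a, 0 < x a) ∧ r ^ 2 < ∏ a, x a} ⊆
      Set.univ.pi fun _ => Set.Ioi 0 := fun x hx => by simpa using hx.1
  have hid : ∀ x : Fin n → ℝ, (∏ a, erlangDensity (N a) (x a)) * (∏ a, x a) ^ s =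
      (∏ a, (((N a + s).factorial : ℝ) / (N a).factorial)) *
        ∏ a, erlangDensity (N a + s) (x a) := by
    intro x
    rw [← Finset.prod_pow, ← Finset.prod_mul_distrib, ← Finset.prod_mul_distrib]
    refine Finset.prod_congr rfl fun a _ => ?_
    simp only [erlangDensity]
    have : ((N a).factorial : ℝ) ≠ 0 := by positivity
    have : ((N a + s).factorial : ℝ) ≠ 0 := by positivity
    field_simp
    ring
  have hint := (prod_erlangDensity_orthant (fun a => N a + s) le_rfl)
  have hc : 0 ≤ ∏ a, (((N a + s).factorial : ℝ) / (N a).factorial) := by positivity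
  rw [erlangProductTail, ← integral_mul_const]
  calc _ ≤ ∫ x : Fin n → ℝ in {x | (∀ a, 0 < x a) ∧ r ^ 2 < ∏ a, x a},
          (∏ a, (((N a + s).factorial : ℝ) / (N a).factorial)) *
            ∏ a, erlangDensity (N a + s) (x a) := by
        refine setIntegral_mono_on ?_ ((hint.1.mono_set hsub).const_mul _) hmeas fun x hx => ?_
        · exact ((prod_erlangDensity_orthant N le_rfl).1.mono_set hsub).mul_const _
        · rw [← hid]
          refine mul_le_mul_of_nonneg_left (pow_le_pow_left₀ (sq_nonneg r) hx.2.le s) ?_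
          exact Finset.prod_nonneg fun a _ => erlangDensity_nonneg _ (hx.1 a).le
    _ = (∏ a, (((N a + s).factorial : ℝ) / (N a).factorial)) *
          ∫ x : Fin n → ℝ in {x | (∀ a, 0 < x a) ∧ r ^ 2 < ∏ a, x a},
            ∏ a, erlangDensity (N a + s) (x a) := integral_const_mul _ _
    _ ≤ (∏ a, (((N a + s).factorial : ℝ) / (N a).factorial)) * 1 := by
        refine mul_le_mul_of_nonneg_left ?_ hc
        calc _ ≤ _ := by
              refine setIntegral_mono_set hint.1 ?_ (LE.le.eventuallyLE hsub)
              refine (ae_restrict_mem (MeasurableSet.univ_pi fun _ => measurableSet_Ioi)).mono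
                fun x hx => ?_
              have hx' : ∀ a, 0 < x a := by simpa using hx
              exact Finset.prod_nonneg fun a _ => erlangDensity_nonneg _ (hx' a).le
          _ = ∏ a, poissonLowerTail (N a + s) 0 := hint.2
          _ = 1 := by simp [poissonLowerTail_zero_right]
    _ = _ := mul_one _

lemma pow_div_factorial_le_poissonLowerTail {N j : ℕ} (hj : j ≤ N) {R : ℝ} (hR : 0 ≤ R) :
    exp (-R) * (R ^ j / j.factorial) ≤ poissonLowerTail N R := by
  refine mul_le_mul_of_nonneg_left ?_ (exp_pos _).le
  exact Finset.single_le_sum (f := fun j : ℕ => R ^ j / (j.factorial : ℝ))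
    (fun i _ => by positivity) (Finset.mem_range.mpr (Nat.lt_succ_of_le hj))

lemma hasSum_ite_mem_range (K : ℕ) (f : ℕ → ℝ) :
    HasSum (fun k => if k ∈ Finset.range K then f k else 0) (∑ k ∈ Finset.range K, f k) := by
  have := hasSum_sum_of_ne_finset_zero (L := SummationFilter.unconditional ℕ)
    (s := Finset.range K) (f := fun k => if k ∈ Finset.range K then f k else 0)
    fun j hj => if_neg hj
  convert this using 1
  exact Finset.sum_congr rfl fun j hj => (if_pos hj).symm

lemma one_sub_exp_le_poissonLowerTail (N : ℕ) {R : ℝ} (hR : 0 ≤ R) :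
    1 - exp (2 * R - N) ≤ poissonLowerTail N R := by
  have hs (x : ℝ) : HasSum (fun j : ℕ => x ^ j / (j.factorial : ℝ)) (exp x) := by
    rw [Real.exp_eq_exp_ℝ]
    exact NormedSpace.expSeries_div_hasSum_exp x
  have h1 := hasSum_ite_mem_range (N + 1) fun j : ℕ => R ^ j / (j.factorial : ℝ)
  have h2 := h1.add ((hs (exp 1 * R)).mul_left (exp (-N)))
  have hterm : ∀ j : ℕ, R ^ j / (j.factorial : ℝ) ≤
      (if j ∈ Finset.range (N + 1) then R ^ j / (j.factorial : ℝ) else 0) +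
        exp (-N) * ((exp 1 * R) ^ j / (j.factorial : ℝ)) := by
    intro j
    have hp : 0 ≤ R ^ j / (j.factorial : ℝ) := by positivity
    have hq : 0 ≤ exp (-(N : ℝ)) * ((exp 1 * R) ^ j / (j.factorial : ℝ)) := by positivity
    by_cases hj : j ∈ Finset.range (N + 1)
    · simp only [if_pos hj]; linarith
    · simp only [if_neg hj, zero_add]
      have hNj : (N : ℝ) ≤ j := by
        rw [Finset.mem_range] at hj
        exact_mod_cast (by omega : N ≤ j)
      have : exp (-(N : ℝ)) * ((exp 1 * R) ^ j / (j.factorial : ℝ)) =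
          exp (j - N) * (R ^ j / (j.factorial : ℝ)) := by
        rw [mul_pow, ← exp_nat_mul, sub_eq_neg_add, exp_add]
        ring_nf
      rw [this]
      exact le_mul_of_one_le_left hp (one_le_exp (by linarith))
  have hle := hasSum_le hterm (hs R) h2
  have he : exp (-R) * exp R = 1 := by rw [← exp_add]; simp
  have h3 : exp (-R) * (exp (-N) * exp (exp 1 * R)) ≤ exp (2 * R - N) := by
    rw [← exp_add, ← exp_add]
    refine exp_le_exp.mpr ?_
    nlinarith [Real.exp_one_lt_three]
  have := mul_le_mul_of_nonneg_left hle (exp_pos (-R)).le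
  rw [poissonLowerTail]
  linarith

lemma inv_add_one_le_log_add_one_sub_log {x : ℝ} (hx : 0 < x) :
    1 / (x + 1) ≤ log (x + 1) - log x ∧ log (x + 1) - log x ≤ 1 / x := by
  have hx1 : 0 < x + 1 := by linarith
  rw [← log_div hx1.ne' hx.ne']
  constructor
  · have h := one_sub_inv_le_log_of_pos (div_pos hx1 hx)
    refine le_trans (le_of_eq ?_) h
    field_simp
    ring
  · have h := log_le_sub_one_of_pos (div_pos hx1 hx)
    refine h.trans (le_of_eq ?_)
    field_simp
    ring

lemma log_factorial_succ (N : ℕ) :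
    log ((N + 1).factorial : ℝ) = log ((N : ℝ) + 1) + log (N.factorial : ℝ) := by
  rw [Nat.factorial_succ, Nat.cast_mul, log_mul (by positivity) (by positivity)]
  push_cast
  rfl

lemma le_log_factorial (N : ℕ) : N * log N - N ≤ log (N.factorial : ℝ) := by
  have h := pow_div_factorial_le_exp (N : ℝ) (Nat.cast_nonneg N) N
  rcases Nat.eq_zero_or_pos N with rfl | hN
  · simp
  · have hN' : (0 : ℝ) < N := by exact_mod_cast hN
    have h' := log_le_log (by positivity) h
    rw [log_exp, log_div (by positivity) (by positivity), log_pow] at h'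
    linarith

lemma log_factorial_le {N : ℕ} (hN : 1 ≤ N) :
    log (N.factorial : ℝ) ≤ (N + 1) * log N - N + 1 := by
  induction N, hN using Nat.le_induction with
  | base => simp
  | succ N hN ih =>
    have hN' : (0 : ℝ) < N := by exact_mod_cast hN
    have h := (inv_add_one_le_log_add_one_sub_log hN').1
    rw [div_le_iff₀ (by linarith)] at h
    rw [log_factorial_succ]
    push_cast
    linarith

lemma log_factorial_add_le (N m : ℕ) :
    log ((N + m).factorial : ℝ) ≤ log (N.factorial : ℝ) + m * log ((N : ℝ) + m) := by
  induction m with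
  | zero => simp
  | succ m ih =>
    rw [← add_assoc, log_factorial_succ]
    have hmono : m * log ((N : ℝ) + m) ≤ m * log ((N : ℝ) + m + 1) := by
      rcases Nat.eq_zero_or_pos m with rfl | hm
      · simp
      · have : (0 : ℝ) < m := by exact_mod_cast hm
        exact mul_le_mul_of_nonneg_left (log_le_log (by positivity) (by linarith)) this.le
    push_cast
    rw [← add_assoc]
    linarith

/-- The main term of `∑ k ≤ x, log (2 k)!`. -/
noncomputable def sumLogFactorialMain (x : ℝ) : ℝ := x ^ 2 * log (2 * x) - 3 / 2 * x ^ 2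

lemma sumLogFactorialMain_step (K : ℕ) :
    |log ((2 * (K + 1)).factorial : ℝ) -
        (sumLogFactorialMain (K + 1) - sumLogFactorialMain K)| ≤
      2 * log (2 * ((K : ℝ) + 1)) + 2 := by
  have h1 := le_log_factorial (2 * (K + 1))
  have h2 := log_factorial_le (N := 2 * (K + 1)) (by omega)
  have hl : 0 ≤ log (2 * ((K : ℝ) + 1)) := log_nonneg (by linarith [Nat.cast_nonneg (α := ℝ) K])
  push_cast at h1 h2
  have hd : (K : ℝ) - 1 ≤ K ^ 2 * (log (2 * ((K : ℝ) + 1)) - log (2 * K)) ∧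
      K ^ 2 * (log (2 * ((K : ℝ) + 1)) - log (2 * K)) ≤ K := by
    rcases Nat.eq_zero_or_pos K with rfl | hK
    · simp
    · have hK' : (1 : ℝ) ≤ K := by exact_mod_cast hK
      obtain ⟨ha, hb⟩ := inv_add_one_le_log_add_one_sub_log (show (0 : ℝ) < K by linarith)
      rw [div_le_iff₀ (by linarith)] at ha
      rw [le_div_iff₀ (by linarith)] at hb
      rw [log_mul two_ne_zero (by linarith), log_mul two_ne_zero (by linarith)]
      constructor <;> nlinarith
  simp only [sumLogFactorialMain]
  rw [abs_le]
  constructor <;> nlinarith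

lemma abs_sum_log_factorial_sub_le (K : ℕ) :
    |∑ k ∈ Finset.range K, log ((2 * (k + 1)).factorial : ℝ) - sumLogFactorialMain K| ≤
      K * (2 * log (2 * K) + 2) := by
  induction K with
  | zero => simp [sumLogFactorialMain]
  | succ K ih =>
    rw [Finset.sum_range_succ]
    have hstep := sumLogFactorialMain_step K
    have hmono : (K : ℝ) * log (2 * K) ≤ K * log (2 * ((K : ℝ) + 1)) := by
      rcases Nat.eq_zero_or_pos K with rfl | hK
      · simp
      · have : (0 : ℝ) < K := by exact_mod_cast hK
        gcongr
        linarith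
    rw [abs_le] at *
    push_cast
    constructor <;> nlinarith

lemma sum_range_two_mul_add_one (K : ℕ) :
    ∑ k ∈ Finset.range K, (2 * (k : ℝ) + 1) = (K : ℝ) ^ 2 := by
  induction K with
  | zero => simp
  | succ K ih => rw [Finset.sum_range_succ, ih]; push_cast; ring

lemma poissonLowerTail_pos (N : ℕ) {R : ℝ} (hR : 0 ≤ R) : 0 < poissonLowerTail N R :=
  lt_of_lt_of_le (by simpa using exp_pos (-R))
    (pow_div_factorial_le_poissonLowerTail (Nat.zero_le N) hR)

lemma neg_log_poissonLowerTail_le_of_le {N j : ℕ} (hj : j ≤ N) {R : ℝ} (hR : 0 < R) :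
    -log (poissonLowerTail N R) ≤ R - j * log R + log (j.factorial : ℝ) := by
  have h := log_le_log (by positivity) (pow_div_factorial_le_poissonLowerTail hj hR.le)
  rw [log_mul (by positivity) (by positivity), log_exp, log_div (by positivity) (by positivity),
    log_pow] at h
  linarith

/-- A summable majorant of the sequence `-log (poissonLowerTail (2 * k + 1 + m) R)`. -/
noncomputable def tailMajorant (K : ℕ) (R : ℝ) (k : ℕ) : ℝ :=
  (if k ∈ Finset.range K then R - (2 * (k : ℝ) + 1) * log R + log ((2 * (k + 1)).factorial : ℝ)
      else 0) +
    (if k ∈ Finset.range (4 * K + 4) then log (2 * K) + 3 else 0) + (1 / 2) ^ k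

lemma hasSum_tailMajorant (K : ℕ) (R : ℝ) :
    HasSum (tailMajorant K R)
      (K * R - K ^ 2 * log R + ∑ k ∈ Finset.range K, log ((2 * (k + 1)).factorial : ℝ) +
        (4 * K + 4) * (log (2 * K) + 3) + 2) := by
  have h := ((hasSum_ite_mem_range K fun k : ℕ =>
    R - (2 * (k : ℝ) + 1) * log R + log ((2 * (k + 1)).factorial : ℝ)).add
      (hasSum_ite_mem_range (4 * K + 4) fun _ => log (2 * K) + 3)).add hasSum_geometric_two
  rw [Finset.sum_add_distrib, Finset.sum_sub_distrib, ← Finset.sum_mul,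
    sum_range_two_mul_add_one] at h
  simp only [Finset.sum_const, Finset.card_range, nsmul_eq_mul] at h
  push_cast at h
  exact h

lemma neg_log_poissonLowerTail_le_tailMajorant {K : ℕ} (hK : 1 ≤ K) {R : ℝ} (hKR : 2 * K ≤ R)
    (hRK : R < 2 * K + 2) (k m : ℕ) :
    -log (poissonLowerTail (2 * k + 1 + m) R) ≤ tailMajorant K R k := by
  have hK' : (1 : ℝ) ≤ K := by exact_mod_cast hK
  have hR : 0 < R := by linarith
  have hl : 0 ≤ log (2 * (K : ℝ)) := log_nonneg (by linarith)
  have hg : (0 : ℝ) ≤ (1 / 2) ^ k := by positivity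
  unfold tailMajorant
  by_cases h1 : k < K
  · have h := neg_log_poissonLowerTail_le_of_le (show 2 * k + 1 ≤ 2 * k + 1 + m by omega) hR
    have hmono : log ((2 * k + 1).factorial : ℝ) ≤ log ((2 * (k + 1)).factorial : ℝ) := by
      refine log_le_log (by positivity) ?_
      exact_mod_cast Nat.factorial_le (by omega)
    rw [if_pos (Finset.mem_range.mpr h1), if_pos (Finset.mem_range.mpr (by omega))]
    push_cast at h
    linarith
  rw [if_neg (by simpa using h1)]
  by_cases h2 : k < 4 * K + 4
  · have h := neg_log_poissonLowerTail_le_of_le (show 2 * K ≤ 2 * k + 1 + m by omega) hR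
    have hf := log_factorial_le (N := 2 * K) (by omega)
    have hlog : log (2 * (K : ℝ)) ≤ log R := log_le_log (by linarith) hKR
    rw [if_pos (Finset.mem_range.mpr h2)]
    push_cast at h hf
    nlinarith
  · rw [if_neg (by simpa using h2)]
    have h := one_sub_exp_le_poissonLowerTail (2 * k + 1 + m) hR.le
    have hk : 4 * (K : ℝ) + 4 ≤ k := by exact_mod_cast (by omega : 4 * K + 4 ≤ k)
    have he : exp (2 * R - (2 * k + 1 + m : ℕ)) ≤ (1 / 2) ^ (k + 1) := by
      calc exp (2 * R - (2 * k + 1 + m : ℕ)) ≤ exp (((k + 1 : ℕ) : ℝ) * (-1)) := by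
            refine exp_le_exp.mpr ?_
            push_cast
            linarith [Nat.cast_nonneg (α := ℝ) m]
        _ = exp (-1) ^ (k + 1) := exp_nat_mul _ _
        _ ≤ (1 / 2) ^ (k + 1) := by
            refine pow_le_pow_left₀ (exp_pos _).le ?_ _
            linarith [Real.exp_neg_one_lt_d9]
    have hp : (1 / 2 : ℝ) ^ (k + 1) = (1 / 2) ^ k / 2 := by ring
    have hg1 : (1 / 2 : ℝ) ^ k ≤ 1 := pow_le_one₀ (by norm_num) (by norm_num)
    set y : ℝ := (1 / 2) ^ k
    set Q := poissonLowerTail (2 * k + 1 + m) R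
    have hQ : 1 - y / 2 ≤ Q := by linarith
    have hQ0 : 0 < Q := by linarith
    have hlog := one_sub_inv_le_log_of_pos hQ0
    have hinv : Q⁻¹ ≤ 1 + y := by
      rw [inv_le_comm₀ hQ0 (by linarith)]
      refine le_trans ?_ hQ
      rw [inv_le_iff_one_le_mul₀ (by linarith)]
      nlinarith
    linarith

section HoleProbability

variable {n : ℕ} (m : Fin n → ℕ) {r R : ℝ}

lemma erlangProductTail_le_one (N : Fin n → ℕ) (r : ℝ) : erlangProductTail N r ≤ 1 := by
  have h := erlangProductTail_mul_le N 0 r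
  have h1 : ∀ a, ((N a).factorial : ℝ) / (N a).factorial = 1 := fun a => div_self (by positivity)
  simpa [h1] using h

lemma erlangProductTail_pos (hn : 1 ≤ n) (N : Fin n → ℕ) (hR : 0 < R) (hRr : R ^ n = r ^ 2) :
    0 < erlangProductTail N r :=
  lt_of_lt_of_le (Finset.prod_pos fun a _ => poissonLowerTail_pos (N a) hR.le)
    (prod_poissonLowerTail_le_erlangProductTail hn N hR hRr)

lemma neg_log_erlangProductTail_le (hn : 1 ≤ n) (hRr : R ^ n = r ^ 2) {K : ℕ} (hK : 1 ≤ K)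
    (hKR : 2 * K ≤ R) (hRK : R < 2 * K + 2) (k : ℕ) :
    -log (erlangProductTail (fun a => 2 * k + 1 + m a) r) ≤ n * tailMajorant K R k := by
  have hK' : (1 : ℝ) ≤ K := by exact_mod_cast hK
  have hR : 0 < R := by linarith
  have h := log_le_log (Finset.prod_pos fun a _ => poissonLowerTail_pos (2 * k + 1 + m a) hR.le)
    (prod_poissonLowerTail_le_erlangProductTail hn (fun a => 2 * k + 1 + m a) hR hRr)
  rw [log_prod (fun a _ => (poissonLowerTail_pos _ hR.le).ne')] at h
  have hs := Finset.sum_le_sum fun a (_ : a ∈ Finset.univ) =>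
    neg_log_poissonLowerTail_le_tailMajorant hK hKR hRK k (m a)
  simp only [Finset.sum_neg_distrib, Finset.sum_const, Finset.card_univ, Fintype.card_fin,
    nsmul_eq_mul] at hs
  linarith

lemma log_erlangProductTail_le (hn : 1 ≤ n) (hRr : R ^ n = r ^ 2) (hR : 0 < R) {K k : ℕ}
    (hk : k < K) :
    log (erlangProductTail (fun a => 2 * k + 1 + m a) r) ≤
      n * (log ((2 * K).factorial : ℝ) +
        (∑ a, m a : ℕ) * log (2 * K + (∑ a, m a : ℕ)) - log ((2 * (k + 1)).factorial : ℝ) +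
        log (2 * K) - (2 * K - 2 * ((k : ℝ) + 1)) * log R) := by
  have hK : (1 : ℝ) ≤ K := by exact_mod_cast (by omega : 1 ≤ K)
  have hkK : (k : ℝ) + 1 ≤ K := by exact_mod_cast hk
  obtain ⟨s, rfl⟩ : ∃ s, K = k + 1 + s := Nat.exists_eq_add_of_le hk
  have hp := erlangProductTail_pos hn (fun a => 2 * k + 1 + m a) hR hRr
  have h := erlangProductTail_mul_le (fun a => 2 * k + 1 + m a) (2 * s) r
  rw [← hRr] at h
  have h' := log_le_log (by positivity) h
  rw [log_mul hp.ne' (by positivity), log_pow, log_pow,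
    log_prod (fun a _ => by positivity)] at h'
  have hs := Finset.sum_le_sum fun a (_ : a ∈ Finset.univ) =>
    show log (((2 * k + 1 + m a + 2 * s).factorial : ℝ) / (2 * k + 1 + m a).factorial) ≤
      log ((2 * (k + 1 + s)).factorial : ℝ) +
        (∑ a, m a : ℕ) * log (2 * (k + 1 + s : ℕ) + (∑ a, m a : ℕ)) -
        log ((2 * (k + 1)).factorial : ℝ) + log (2 * (k + 1 + s : ℕ)) by
      rw [log_div (by positivity) (by positivity)]
      have hma : m a ≤ ∑ a, m a := Finset.single_le_sum (fun _ _ => Nat.zero_le _)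
        (Finset.mem_univ a)
      have h1 : log ((2 * k + 1 + m a + 2 * s).factorial : ℝ) ≤
          log ((2 * (k + 1 + s) + ∑ a, m a).factorial : ℝ) := by
        refine log_le_log (by positivity) ?_
        exact_mod_cast Nat.factorial_le (by omega)
      have h2 := log_factorial_add_le (2 * (k + 1 + s)) (∑ a, m a)
      have h3 : log ((2 * k + 1).factorial : ℝ) ≤ log ((2 * k + 1 + m a).factorial : ℝ) := by
        refine log_le_log (by positivity) ?_
        exact_mod_cast Nat.factorial_le (by omega)
      have h4 := log_factorial_succ (2 * k + 1)
      have h5 : log (((2 * k + 1 : ℕ) : ℝ) + 1) ≤ log (2 * (k + 1 + s : ℕ)) := by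
        refine log_le_log (by positivity) ?_
        push_cast
        linarith [Nat.cast_nonneg (α := ℝ) s]
      rw [show 2 * k + 1 + 1 = 2 * (k + 1) by ring] at h4
      rw [Nat.cast_mul 2 (k + 1 + s), Nat.cast_ofNat] at h2
      linarith
  simp only [Finset.sum_const, Finset.card_univ, Fintype.card_fin, nsmul_eq_mul] at hs
  have h6 := h'.trans hs
  have h7 : (2 * ((k + 1 + s : ℕ) : ℝ) - 2 * ((k : ℝ) + 1)) = ((2 * s : ℕ) : ℝ) := by
    push_cast; ring
  rw [h7]
  linarith

lemma log_tprod_bounds (hn : 1 ≤ n) (hRr : R ^ n = r ^ 2) {K : ℕ} (hK : 1 ≤ K)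
    (hKR : 2 * K ≤ R) (hRK : R < 2 * K + 2) :
    -(n * (K * R - K ^ 2 * log R + ∑ k ∈ Finset.range K, log ((2 * (k + 1)).factorial : ℝ) +
        (4 * K + 4) * (log (2 * K) + 3) + 2)) ≤
      log (∏' k : ℕ, erlangProductTail (fun a => 2 * k + 1 + m a) r) ∧
    log (∏' k : ℕ, erlangProductTail (fun a => 2 * k + 1 + m a) r) ≤
      n * (K * log ((2 * K).factorial : ℝ) +
        K * ((∑ a, m a : ℕ) * log (2 * K + (∑ a, m a : ℕ))) -
        ∑ k ∈ Finset.range K, log ((2 * (k + 1)).factorial : ℝ) +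
        K * log (2 * K) - (K ^ 2 - K) * log R) := by
  have hK' : (1 : ℝ) ≤ K := by exact_mod_cast hK
  have hR : 0 < R := by linarith
  set p : ℕ → ℝ := fun k => erlangProductTail (fun a => 2 * k + 1 + m a) r
  have hpos : ∀ k, 0 < p k := fun k => erlangProductTail_pos hn _ hR hRr
  have hlog : ∀ k, 0 ≤ -log (p k) := fun k => by
    have := log_nonpos (hpos k).le (erlangProductTail_le_one _ _)
    linarith
  have hmaj := (hasSum_tailMajorant K R).mul_left (n : ℝ)
  have hle : ∀ k, -log (p k) ≤ n * tailMajorant K R k :=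
    neg_log_erlangProductTail_le m hn hRr hK hKR hRK
  have hsum : Summable fun k => -log (p k) := Summable.of_nonneg_of_le hlog hle hmaj.summable
  have hsum' : Summable fun k => log (p k) := by simpa using hsum.neg
  have hprod : log (∏' k, p k) = -∑' k, -log (p k) := by
    rw [← rexp_tsum_eq_tprod hpos hsum', log_exp, tsum_neg, neg_neg]
  rw [hprod]
  constructor
  · exact neg_le_neg (hasSum_le hle hsum.hasSum hmaj)
  · have h1 := hsum.sum_le_tsum (Finset.range K) fun k _ => hlog k
    rw [Finset.sum_neg_distrib] at h1
    have h2 := Finset.sum_le_sum fun k (hk : k ∈ Finset.range K) =>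
      log_erlangProductTail_le m hn hRr hR (Finset.mem_range.mp hk)
    have h3 : ∑ k ∈ Finset.range K, (2 * (K : ℝ) - 2 * ((k : ℝ) + 1)) = K ^ 2 - K := by
      have := sum_range_two_mul_add_one K
      have h4 : ∀ k : ℕ, (2 * (K : ℝ) - 2 * ((k : ℝ) + 1)) =
        (2 * (K : ℝ) - 1) - (2 * (k : ℝ) + 1) := fun k => by ring
      simp only [h4]
      rw [Finset.sum_sub_distrib, this]
      simp
      ring
    rw [← Finset.mul_sum, Finset.sum_sub_distrib, ← Finset.sum_mul, h3, Finset.sum_add_distrib,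
      Finset.sum_sub_distrib] at h2
    simp only [Finset.sum_const, Finset.card_range, nsmul_eq_mul] at h2
    linarith

lemma abs_log_tprod_add_le (hn : 1 ≤ n) (hRr : R ^ n = r ^ 2) (hR : 2 ≤ R) :
    |log (∏' k : ℕ, erlangProductTail (fun a => 2 * k + 1 + m a) r) + n * R ^ 2 / 8| ≤
      n * (R * ((15 + (∑ a, m a : ℕ) + (∑ a, m a : ℕ) ^ 2) * (log R + 1))) := by
  obtain ⟨K, hKR, hRK⟩ : ∃ K : ℕ, 2 * (K : ℝ) ≤ R ∧ R < 2 * K + 2 := by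
    refine ⟨⌊R / 2⌋₊, ?_, ?_⟩
    · linarith [Nat.floor_le (show 0 ≤ R / 2 by linarith)]
    · linarith [Nat.lt_floor_add_one (R / 2)]
  have hK : 1 ≤ K := by
    have : (0 : ℝ) < K := by linarith
    exact_mod_cast this
  have hK' : (1 : ℝ) ≤ K := by exact_mod_cast hK
  have hn' : (0 : ℝ) ≤ n := Nat.cast_nonneg n
  obtain ⟨hlow, hup⟩ := log_tprod_bounds m hn hRr hK hKR hRK
  set X := log (∏' k : ℕ, erlangProductTail (fun a => 2 * k + 1 + m a) r)
  set M : ℝ := ((∑ a, m a : ℕ) : ℝ)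
  have hM0 : 0 ≤ M := Nat.cast_nonneg _
  set T := ∑ k ∈ Finset.range K, log ((2 * (k + 1)).factorial : ℝ)
  have hT := abs_sum_log_factorial_sub_le K
  rw [abs_le, sumLogFactorialMain] at hT
  have hf := log_factorial_le (N := 2 * K) (by omega)
  push_cast at hf
  have hl0 : 0 ≤ log (2 * (K : ℝ)) := log_nonneg (by linarith)
  have hlR : log (2 * (K : ℝ)) ≤ log R := log_le_log (by linarith) hKR
  have hlM : log (2 * K + M) ≤ log R + M := by
    calc log (2 * K + M) ≤ log (R * (M + 1)) := log_le_log (by linarith) (by nlinarith)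
      _ = log R + log (M + 1) := log_mul (by linarith) (by linarith)
      _ ≤ log R + M := by linarith [log_le_sub_one_of_pos (show 0 < M + 1 by linarith)]
  set l := log (2 * (K : ℝ))
  set q := log R
  have hq0 : 0 ≤ q := hl0.trans hlR
  have hKl : K * l ≤ K * q := mul_le_mul_of_nonneg_left hlR (by linarith)
  have hKq : 0 ≤ K * q := by positivity
  have hRKq : 2 * (K * q) ≤ R * q := by nlinarith
  have hMq : 0 ≤ R * (M * q) := by positivity
  have hM2q : 0 ≤ R * (M ^ 2 * q) := by positivity
  have hRM : 0 ≤ R * M := by positivity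
  have hlow' : K * R - K ^ 2 * q + T + (4 * K + 4) * (l + 3) + 2 ≤
      R ^ 2 / 8 + R * ((15 + M + M ^ 2) * (q + 1)) := by
    have h1 : K * R ≤ K * (2 * K + 2) := mul_le_mul_of_nonneg_left hRK.le (by linarith)
    have h2 : (K : ℝ) ^ 2 * l ≤ K ^ 2 * q := mul_le_mul_of_nonneg_left hlR (by positivity)
    have h3 : l ≤ K * q := hlR.trans (le_mul_of_one_le_left hq0 hK')
    have h4 : (2 * (K : ℝ)) ^ 2 ≤ R ^ 2 := pow_le_pow_left₀ (by linarith) hKR 2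
    have h5 : 0 ≤ R * M ^ 2 := by positivity
    linarith
  have hup' : K * log ((2 * K).factorial : ℝ) + K * (M * log (2 * K + M)) - T + K * l -
      (K ^ 2 - K) * q ≤ -(R ^ 2 / 8) + R * ((15 + M + M ^ 2) * (q + 1)) := by
    have h1 := mul_le_mul_of_nonneg_left hf (show (0 : ℝ) ≤ K by linarith)
    have h2 : (K : ℝ) ^ 2 * l ≤ K ^ 2 * q := mul_le_mul_of_nonneg_left hlR (by positivity)
    have h3 : K * (M * log (2 * K + M)) ≤ R * (M * (q + M)) := by
      refine mul_le_mul (by linarith) (mul_le_mul_of_nonneg_left hlM hM0) ?_ (by linarith)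
      exact mul_nonneg hM0 (log_nonneg (by linarith))
    have h4 : R ^ 2 ≤ (2 * (K : ℝ) + 2) ^ 2 := pow_le_pow_left₀ (by linarith) hRK.le 2
    linarith
  have hlow'' := mul_le_mul_of_nonneg_left hlow' hn'
  have hup'' := mul_le_mul_of_nonneg_left hup' hn'
  rw [abs_le]
  constructor <;> linarith

end HoleProbability

/-- The leading-order decay of the hole probability of the generalised induced infinite
quaternion Ginibre ensemble:
`lim_{r→∞} r^{-4/n} log(∏_{k=1}^∞ p_k^{ℍ}(r)) = -n/8`, where `p_k^{ℍ}(r)` is the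
probability that a product of `n` independent Gamma variables with shapes
`2k+m_1, …, 2k+m_n` and rate `1` exceeds `r²`. -/
theorem quaternion_hole_probability_infinite_leading_order
    (n : ℕ) (hn : 1 ≤ n) (m : Fin n → ℕ)
    (pH : ℕ → ℝ → ℝ)
    (hpH : ∀ (k : ℕ) (r : ℝ), pH k r =
      ∫ x : Fin n → ℝ in {x | (∀ a, 0 < x a) ∧ r ^ 2 < ∏ a, x a},
        ∏ a, x a ^ ((2 * k : ℝ) + (m a : ℝ) - 1) * Real.exp (-x a) /
          Real.Gamma ((2 * k : ℝ) + (m a : ℝ))) :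
    Tendsto (fun r : ℝ => (r ^ ((4 : ℝ) / n))⁻¹ * Real.log (∏' k : ℕ, pH (k + 1) r))
      atTop (nhds (-((n : ℝ) / 8))) := by
  have hn' : (0 : ℝ) < n := by exact_mod_cast hn
  have hp : ∀ (k : ℕ) (r : ℝ), pH (k + 1) r = erlangProductTail (fun a => 2 * k + 1 + m a) r := by
    intro k r
    rw [hpH, erlangProductTail]
    congr 1
    ext x
    refine Finset.prod_congr rfl fun a _ => ?_
    have h1 : (2 * ((k + 1 : ℕ) : ℝ)) + (m a : ℝ) = ((2 * k + 1 + m a : ℕ) : ℝ) + 1 := by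
      push_cast; ring
    rw [h1, Gamma_nat_eq_factorial, add_sub_cancel_right, rpow_natCast, erlangDensity]
  simp only [hp]
  have hscale : Tendsto (fun r : ℝ => r ^ ((2 : ℝ) / n)) atTop atTop :=
    tendsto_rpow_atTop (by positivity)
  set C : ℝ := 15 + (∑ a, m a : ℕ) + (∑ a, m a : ℕ) ^ 2
  have herr : Tendsto (fun R : ℝ => n * (C * (log R / R + 1 / R))) atTop (nhds 0) := by
    have h1 : Tendsto (fun R : ℝ => log R / R) atTop (nhds 0) :=
      isLittleO_log_id_atTop.tendsto_div_nhds_zero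
    have h2 : Tendsto (fun R : ℝ => 1 / R) atTop (nhds 0) := by
      simpa using tendsto_inv_atTop_zero (𝕜 := ℝ)
    simpa using ((h1.add h2).const_mul C).const_mul (n : ℝ)
  rw [tendsto_iff_norm_sub_tendsto_zero]
  refine squeeze_zero' (Eventually.of_forall fun _ => norm_nonneg _) ?_ (herr.comp hscale)
  filter_upwards [hscale.eventually_ge_atTop 2, eventually_gt_atTop 0] with r hr2 hr0
  have hpow : (r ^ ((2 : ℝ) / n)) ^ n = r ^ 2 := by
    rw [← rpow_natCast, ← rpow_mul hr0.le, div_mul_cancel₀ _ hn'.ne']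
    exact_mod_cast rpow_natCast r 2
  have hsq : r ^ ((4 : ℝ) / n) = (r ^ ((2 : ℝ) / n)) ^ 2 := by
    rw [← rpow_natCast, ← rpow_mul hr0.le]
    congr 1
    push_cast
    ring
  have hmain := abs_log_tprod_add_le m hn hpow hr2
  rw [hsq]
  simp only [Function.comp_apply]
  set R := r ^ ((2 : ℝ) / n)
  have hR : 0 < R := by linarith
  rw [Real.norm_eq_abs]
  set X := log (∏' k : ℕ, erlangProductTail (fun a => 2 * k + 1 + m a) r)
  have h1 : (R ^ 2)⁻¹ * X - -((n : ℝ) / 8) = (R ^ 2)⁻¹ * (X + n * R ^ 2 / 8) := by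
    field_simp
    ring
  rw [h1, abs_mul, abs_of_pos (by positivity)]
  calc (R ^ 2)⁻¹ * |X + n * R ^ 2 / 8| ≤ (R ^ 2)⁻¹ * (n * (R * (C * (log R + 1)))) :=
        mul_le_mul_of_nonneg_left hmain (by positivity)
    _ = n * (C * (log R / R + 1 / R)) := by
        field_simp
end

section
/- Schur canonical form for quaternion matrices: for every N × N matrix P with entries in the real quaternions ℍ there exists an N × N unitary quaternion matrix U (i.e. U⋆U = UU⋆ = 1, where ⋆ denotes the conjugate transpose obtained from entrywise quaternion conjugation and transposition) such that U⋆ P U is upper triangular, i.e. (U⋆ P U)_{ij} = 0 whenever i > j. -/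
open Matrix

/-- Every square matrix of positive size over the real quaternions has a right eigenvector. -/
theorem exists_quaternion_right_eigenvector {n : ℕ}
    (P : Matrix (Fin (n + 1)) (Fin (n + 1)) (Quaternion ℝ)) :
    ∃ (v : Fin (n + 1) → Quaternion ℝ) (q : Quaternion ℝ),
      v ≠ 0 ∧ ∀ i, (P *ᵥ v) i = v i * q := by
  let φ : ℂ →+* (Quaternion ℝ)ᵐᵒᵖ :=
    (Quaternion.ofComplex : ℂ →+* Quaternion ℝ).toOpposite fun x y => by
      change _ * _ = _ * _
      rw [← map_mul, ← map_mul, mul_comm]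
  let : Module ℂ (Fin (n + 1) → Quaternion ℝ) := Module.compHom _ φ
  have smul_eq (z : ℂ) (v : Fin (n + 1) → Quaternion ℝ) (i) :
      (z • v) i = v i * (z : Quaternion ℝ) := rfl
  have : IsScalarTower ℝ ℂ (Fin (n + 1) → Quaternion ℝ) := by
    refine ⟨fun r z v => funext fun i => ?_⟩
    rw [smul_eq, Pi.smul_apply, smul_eq, ← mul_smul_comm]
    exact congrArg (v i * ·) (map_smul Quaternion.ofComplex r z)
  have : FiniteDimensional ℂ (Fin (n + 1) → Quaternion ℝ) :=
    Module.Finite.of_restrictScalars_finite ℝ ℂ _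
  let f : Module.End ℂ (Fin (n + 1) → Quaternion ℝ) :=
    { toFun := fun v => P *ᵥ v
      map_add' := fun v w => mulVec_add P v w
      map_smul' := fun z v => funext fun i => by
        simp [mulVec, dotProduct, smul_eq, Finset.sum_mul, mul_assoc] }
  obtain ⟨z, hz⟩ := Module.End.exists_eigenvalue f
  obtain ⟨v, hv⟩ := hz.exists_hasEigenvector
  exact ⟨v, z, hv.2, fun i => congrFun hv.apply_eq_smul i⟩

/-- A nonzero quaternion vector can be normalized by a right scalar so that it is a unit vector
with nonnegative real first coordinate. -/
theorem exists_quaternion_normalization {n : ℕ} {v : Fin (n + 1) → Quaternion ℝ} (hv : v ≠ 0) :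
    ∃ (c : Quaternion ℝ) (a : ℝ), c ≠ 0 ∧ 0 ≤ a ∧ v 0 * c = (a : Quaternion ℝ) ∧
      ∑ i, star (v i * c) * (v i * c) = 1 := by
  obtain ⟨s, b, hs, hb, hsb⟩ : ∃ (s : Quaternion ℝ) (b : ℝ), s ≠ 0 ∧ 0 ≤ b ∧
      v 0 * s = (b : Quaternion ℝ) := by
    by_cases h : v 0 = 0
    · exact ⟨1, 0, one_ne_zero, le_rfl, by simp [h]⟩
    · exact ⟨(v 0)⁻¹, 1, inv_ne_zero h, zero_le_one, by simp [h]⟩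
  set t : ℝ := ∑ i, Quaternion.normSq (v i * s) with ht
  have htpos : 0 < t := by
    obtain ⟨i, hi⟩ := Function.ne_iff.mp hv
    refine Finset.sum_pos' (fun _ _ => Quaternion.normSq_nonneg) ⟨i, Finset.mem_univ i, ?_⟩
    exact lt_of_le_of_ne Quaternion.normSq_nonneg
      (Ne.symm (Quaternion.normSq_ne_zero.mpr (mul_ne_zero hi hs)))
  have hr : 0 < (√t)⁻¹ := inv_pos.mpr (Real.sqrt_pos.mpr htpos)
  refine ⟨s * ((√t)⁻¹ : ℝ), b * (√t)⁻¹, mul_ne_zero hs ?_, by positivity, ?_, ?_⟩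
  · exact fun h => hr.ne' (Quaternion.coe_injective h)
  · rw [← mul_assoc, hsb, Quaternion.coe_mul]
  · simp_rw [Quaternion.star_mul_self, ← mul_assoc, map_mul Quaternion.normSq (_ * s),
      Quaternion.normSq_coe]
    have : ∑ i, Quaternion.normSq (v i * s) * (√t)⁻¹ ^ 2 = 1 := by
      rw [← Finset.sum_mul, ← ht, inv_pow, Real.sq_sqrt htpos.le, mul_inv_cancel₀ htpos.ne']
    simpa [pow_two] using congrArg (algebraMap ℝ (Quaternion ℝ)) this

/-- A unit quaternion vector with nonnegative real first coordinate is the first column of a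
Hermitian unitary matrix, given by a Householder reflection. -/
theorem exists_quaternion_householder {n : ℕ} (x : Fin (n + 1) → Quaternion ℝ) {a : ℝ}
    (ha : 0 ≤ a) (hx0 : x 0 = (a : Quaternion ℝ)) (hx : ∑ i, star (x i) * x i = 1) :
    ∃ H : Matrix (Fin (n + 1)) (Fin (n + 1)) (Quaternion ℝ),
      Hᴴ = H ∧ H * H = 1 ∧ ∀ i, H i 0 = x i := by
  have ha' : 1 + a ≠ 0 := by positivity
  set w : Fin (n + 1) → Quaternion ℝ := x + Pi.single 0 1 with hw
  let K : Matrix (Fin (n + 1)) (Fin (n + 1)) (Quaternion ℝ) := vecMulVec w (star w)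
  have hw0 : w 0 = ((1 + a : ℝ) : Quaternion ℝ) := by simp [hw, hx0, add_comm]
  have hww : ∑ i, star (w i) * w i = ((2 * (1 + a) : ℝ) : Quaternion ℝ) := by
    rw [Fin.sum_univ_succ] at hx ⊢
    have hsucc (i : Fin n) : w i.succ = x i.succ := by simp [hw]
    simp only [hsucc, hw0, hx0, Quaternion.star_coe] at hx ⊢
    rw [eq_sub_of_add_eq' hx]
    norm_cast
    ring_nf
  have hK : Kᴴ = K := by
    ext1 i j
    simp [K, vecMulVec_apply]
  have hKK : K * K = (2 * (1 + a)) • K := by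
    ext1 i j
    have : (K * K) i j = w i * (∑ k, star (w k) * w k) * star (w j) := by
      simp [K, mul_apply, vecMulVec_apply, Finset.mul_sum, Finset.sum_mul, mul_assoc]
    rw [this, hww, Quaternion.mul_coe_eq_smul, smul_mul_assoc]
    rfl
  refine ⟨(1 + a)⁻¹ • K - 1, ?_, ?_, fun i => ?_⟩
  · have hsmul : ((1 + a)⁻¹ • K)ᴴ = (1 + a)⁻¹ • Kᴴ := by
      ext1 i j
      exact Quaternion.star_smul _ _
    rw [conjTranspose_sub, hsmul, hK, conjTranspose_one]
  · rw [sub_mul, mul_sub, smul_mul_smul_comm, hKK, mul_one, one_mul, smul_smul,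
      show (1 + a)⁻¹ * (1 + a)⁻¹ * (2 * (1 + a)) = (1 + a)⁻¹ + (1 + a)⁻¹ by field_simp; ring,
      add_smul]
    abel
  · have : K i 0 = (1 + a) • w i := by
      simp only [K, vecMulVec_apply, Pi.star_apply, hw0, Quaternion.star_coe]
      rw [Quaternion.mul_coe_eq_smul]
    rw [Matrix.sub_apply, Matrix.smul_apply, this, smul_smul, inv_mul_cancel₀ ha', one_smul, hw]
    simp [one_apply, Pi.single_apply]

/-- Every quaternion matrix is unitarily similar to one whose first column vanishes below the
diagonal. -/
theorem exists_quaternion_unitary_deflation {n : ℕ}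
    (P : Matrix (Fin (n + 1)) (Fin (n + 1)) (Quaternion ℝ)) :
    ∃ U : Matrix (Fin (n + 1)) (Fin (n + 1)) (Quaternion ℝ),
      U * Uᴴ = 1 ∧ Uᴴ * U = 1 ∧ ∀ i : Fin n, (Uᴴ * P * U) i.succ 0 = 0 := by
  obtain ⟨v, q, hv, hPv⟩ := exists_quaternion_right_eigenvector P
  obtain ⟨c, a, hc, ha, hca, hsum⟩ := exists_quaternion_normalization hv
  obtain ⟨H, hH, hHH, hcol⟩ := exists_quaternion_householder (fun i => v i * c) ha hca hsum
  refine ⟨H, by rw [hH, hHH], by rw [hH, hHH], fun i => ?_⟩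
  have hPH (k) : (P * H) k 0 = H k 0 * (c⁻¹ * q * c) := by
    calc (P * H) k 0 = (P *ᵥ v) k * c := by
          simp [mul_apply, hcol, mulVec, dotProduct, Finset.sum_mul, mul_assoc]
      _ = H k 0 * (c⁻¹ * q * c) := by
          rw [hPv, hcol]
          simp only [mul_assoc, mul_inv_cancel_left₀ hc]
  rw [hH, mul_assoc, mul_apply]
  simp_rw [hPH, ← mul_assoc]
  simp_rw [← Finset.sum_mul, ← mul_apply, hHH]
  simp

/-- The block diagonal matrix with diagonal blocks `1` and `V`. -/
def oneBlockDiag {R : Type*} [Zero R] [One R] {n : ℕ} (V : Matrix (Fin n) (Fin n) R) :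
    Matrix (Fin (n + 1)) (Fin (n + 1)) R :=
  of (Fin.cons (Fin.cons 1 0) fun i => Fin.cons 0 (V i))

section oneBlockDiag

variable {R : Type*} {n : ℕ}

@[simp]
theorem oneBlockDiag_zero_zero [Zero R] [One R] (V : Matrix (Fin n) (Fin n) R) :
    oneBlockDiag V 0 0 = 1 := rfl

@[simp]
theorem oneBlockDiag_zero_succ [Zero R] [One R] (V : Matrix (Fin n) (Fin n) R) (j : Fin n) :
    oneBlockDiag V 0 j.succ = 0 := rfl

@[simp]
theorem oneBlockDiag_succ_zero [Zero R] [One R] (V : Matrix (Fin n) (Fin n) R) (i : Fin n) :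
    oneBlockDiag V i.succ 0 = 0 := rfl

@[simp]
theorem oneBlockDiag_succ_succ [Zero R] [One R] (V : Matrix (Fin n) (Fin n) R) (i j : Fin n) :
    oneBlockDiag V i.succ j.succ = V i j := rfl

theorem oneBlockDiag_one [Zero R] [One R] :
    oneBlockDiag (1 : Matrix (Fin n) (Fin n) R) = 1 := by
  ext i j
  cases i using Fin.cases <;> cases j using Fin.cases <;>
    simp [one_apply, Fin.succ_ne_zero, (Fin.succ_ne_zero _).symm]

theorem oneBlockDiag_mul [Semiring R] (V W : Matrix (Fin n) (Fin n) R) :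
    oneBlockDiag V * oneBlockDiag W = oneBlockDiag (V * W) := by
  ext i j
  cases i using Fin.cases <;> cases j using Fin.cases <;> simp [mul_apply, Fin.sum_univ_succ]

theorem conjTranspose_oneBlockDiag [Semiring R] [StarRing R] (V : Matrix (Fin n) (Fin n) R) :
    (oneBlockDiag V)ᴴ = oneBlockDiag Vᴴ := by
  ext i j
  cases i using Fin.cases <;> cases j using Fin.cases <;> simp

end oneBlockDiag

/-- Schur canonical form for quaternion matrices: every `N × N` matrix over the real
quaternions can be brought to upper triangular form by a unitary quaternion matrix. -/
theorem quaternion_schur_canonical_form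
    (N : ℕ) (P : Matrix (Fin N) (Fin N) (Quaternion ℝ)) :
    ∃ U : Matrix (Fin N) (Fin N) (Quaternion ℝ),
      U * Uᴴ = 1 ∧ Uᴴ * U = 1 ∧
        ∀ i j : Fin N, j < i → (Uᴴ * P * U) i j = 0 := by
  induction N with
  | zero => exact ⟨1, by simp, by simp, fun i => i.elim0⟩
  | succ n ih =>
    obtain ⟨U, hU, hU', hcol⟩ := exists_quaternion_unitary_deflation P
    set A := Uᴴ * P * U with hA
    obtain ⟨V, hV, hV', hT⟩ := ih (A.submatrix Fin.succ Fin.succ)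
    have hW : oneBlockDiag V * (oneBlockDiag V)ᴴ = 1 := by
      rw [conjTranspose_oneBlockDiag, oneBlockDiag_mul, hV, oneBlockDiag_one]
    have hW' : (oneBlockDiag V)ᴴ * oneBlockDiag V = 1 := by
      rw [conjTranspose_oneBlockDiag, oneBlockDiag_mul, hV', oneBlockDiag_one]
    refine ⟨U * oneBlockDiag V, ?_, ?_, fun i j hij => ?_⟩
    · rw [conjTranspose_mul, mul_assoc, ← mul_assoc (oneBlockDiag V), hW, one_mul, hU]
    · rw [conjTranspose_mul, mul_assoc, ← mul_assoc Uᴴ, hU', one_mul, hW']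
    · have hconj : (U * oneBlockDiag V)ᴴ * P * (U * oneBlockDiag V) =
          oneBlockDiag Vᴴ * A * oneBlockDiag V := by
        rw [conjTranspose_mul, conjTranspose_oneBlockDiag, hA]
        simp only [mul_assoc]
      rw [hconj]
      cases i using Fin.cases with
      | zero => exact absurd hij (Fin.not_lt_zero j)
      | succ i =>
        cases j using Fin.cases with
        | zero => simp [mul_apply, Fin.sum_univ_succ, hcol]
        | succ j =>
          have := hT i j (Fin.succ_lt_succ_iff.mp hij)
          simpa [mul_apply, Fin.sum_univ_succ] using this
end

section
/- Generalised Schur decomposition for quaternion matrices: let N and n be positive integers and let M_1, …, M_n be invertible N × N matrices with entries in the real quaternions ℍ. Then there exist N × N unitary quaternion matrices U_1, …, U_n (U_i⋆U_i = U_iU_i⋆ = 1) and N × N upper triangular quaternion matrices S_1, …, S_n ((S_i)_{jk} = 0 for j > k) such that M_i = U_i S_i U_{i+1}⋆ for i = 1, …, n, where U_{n+1} = U_1. -/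
open Matrix

namespace QuaternionSchur

open Quaternion

/-- Every endomorphism of a nonzero finite-dimensional right quaternionic coordinate space has a
right eigenvector. -/
theorem exists_right_eigenvector {N : ℕ}
    (f : (Fin (N + 1) → ℍ[ℝ]) →ₗ[ℍ[ℝ]ᵐᵒᵖ] (Fin (N + 1) → ℍ[ℝ])) :
    ∃ v : Fin (N + 1) → ℍ[ℝ], v ≠ 0 ∧ ∃ q : ℍ[ℝ], ∀ i, f v i = v i * q := by
  let φ : ℂ →+* ℍ[ℝ]ᵐᵒᵖ := (Quaternion.ofComplex : ℂ →ₐ[ℝ] ℍ[ℝ]).toRingHom.toOpposite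
    fun x y ↦ by
      change _ * _ = _ * _
      rw [← map_mul, ← map_mul, mul_comm]
  let _ : Module ℂ (Fin (N + 1) → ℍ[ℝ]) := Module.compHom _ φ
  have hsmul (z : ℂ) (v : Fin (N + 1) → ℍ[ℝ]) (i : Fin (N + 1)) :
      (z • v) i = v i * Quaternion.ofComplex z := rfl
  have : IsScalarTower ℝ ℂ (Fin (N + 1) → ℍ[ℝ]) := ⟨fun r z v ↦ by
    ext1 i
    rw [hsmul, Pi.smul_apply, hsmul, map_smul, mul_smul_comm]⟩
  have : Module.Finite ℂ (Fin (N + 1) → ℍ[ℝ]) :=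
    Module.Finite.of_restrictScalars_finite ℝ ℂ _
  let g : Module.End ℂ (Fin (N + 1) → ℍ[ℝ]) :=
    { toFun := f
      map_add' := f.map_add
      map_smul' := fun z v ↦ f.map_smul (φ z) v }
  obtain ⟨z, hz⟩ := Module.End.exists_eigenvalue g
  obtain ⟨v, hv⟩ := hz.exists_hasEigenvector
  exact ⟨v, hv.2, Quaternion.ofComplex z, fun i ↦ congrFun hv.apply_eq_smul i⟩

theorem exists_mul_eq_neg_norm (a : ℍ[ℝ]) :
    ∃ q : ℍ[ℝ], q * star q = 1 ∧ a * q = ((-‖a‖ : ℝ) : ℍ[ℝ]) := by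
  by_cases ha : a = 0
  · exact ⟨1, by simp, by simp [ha]⟩
  · have hn : ‖a‖ ≠ 0 := norm_ne_zero_iff.mpr ha
    refine ⟨-(‖a‖⁻¹ • star a), ?_, ?_⟩
    · rw [star_neg, neg_mul_neg, Quaternion.star_smul, star_star, smul_mul_smul_comm,
        Quaternion.star_mul_self, Quaternion.normSq_eq_norm_mul_self, Quaternion.smul_coe,
        ← Quaternion.coe_one]
      congr 1
      field_simp
    · rw [mul_neg, mul_smul_comm, Quaternion.self_mul_star, Quaternion.normSq_eq_norm_mul_self,
        Quaternion.smul_coe, Quaternion.coe_neg]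
      congr 2
      field_simp

/-- The Householder reflection: a unit vector whose first coordinate is real and nonpositive is the
first column of a unitary matrix. -/
theorem exists_unitary_first_column {N : ℕ} (w : Fin (N + 1) → ℍ[ℝ]) (t : ℝ) (ht : t ≤ 0)
    (hw0 : w 0 = t) (hw : ∑ i, star (w i) * w i = 1) :
    ∃ V : Matrix (Fin (N + 1)) (Fin (N + 1)) ℍ[ℝ],
      V * Vᴴ = 1 ∧ Vᴴ * V = 1 ∧ ∀ i, V i 0 = w i := by
  let u : Fin (N + 1) → ℍ[ℝ] := w - Pi.single 0 1
  have hu (i) : u i = w i - (Pi.single 0 1 : Fin (N + 1) → ℍ[ℝ]) i := rfl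
  have ht' : 1 - t ≠ 0 := by linarith
  have hu0 : u 0 = ((t - 1 : ℝ) : ℍ[ℝ]) := by simp [hu, hw0]
  have huu : star u ⬝ᵥ u = ((2 * (1 - t) : ℝ) : ℍ[ℝ]) := by
    rw [dotProduct, Fin.sum_univ_succ]
    rw [Fin.sum_univ_succ] at hw
    have h1 : ∑ i : Fin N, star u i.succ * u i.succ = 1 - star (w 0) * w 0 := by
      rw [← hw]
      simp [hu]
    rw [h1, Pi.star_apply, hu0, hw0, Quaternion.star_coe, Quaternion.star_coe,
      ← Quaternion.coe_one]
    simp only [← Quaternion.coe_mul, ← Quaternion.coe_add, ← Quaternion.coe_sub]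
    congr 1
    ring
  let R : Matrix (Fin (N + 1)) (Fin (N + 1)) ℍ[ℝ] := vecMulVec u (star u)
  have hR : Rᴴ = R := by
    ext1 i j
    simp [R, conjTranspose_apply, vecMulVec_apply]
  have hRR : R * R = (2 * (1 - t)) • R := by
    ext1 i j
    have : (R * R) i j = u i * (star u ⬝ᵥ u) * star (u j) := by
      simp [R, mul_apply, vecMulVec_apply, dotProduct, Finset.mul_sum, Finset.sum_mul, mul_assoc]
    rw [this, huu, Quaternion.mul_coe_eq_smul, smul_mul_assoc]
    rfl
  let V := 1 - (1 - t)⁻¹ • R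
  have hV : Vᴴ = V := by
    have h : ((1 - t)⁻¹ • R)ᴴ = (1 - t)⁻¹ • Rᴴ := by
      ext1 i j
      exact Quaternion.star_smul _ _
    rw [conjTranspose_sub, conjTranspose_one, h, hR]
  have hVV : V * V = 1 := by
    simp only [V, Matrix.mul_sub, Matrix.sub_mul, Matrix.one_mul, Matrix.mul_one,
      Matrix.smul_mul, Matrix.mul_smul, hRR, smul_sub, smul_smul]
    have : (1 - t)⁻¹ * ((1 - t)⁻¹ * (2 * (1 - t))) = (1 - t)⁻¹ + (1 - t)⁻¹ := by
      field_simp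
      norm_num
    rw [this, add_smul]
    abel
  refine ⟨V, by rw [hV, hVV], by rw [hV, hVV], fun i ↦ ?_⟩
  have h2 : (1 - t)⁻¹ * (t - 1) = -1 := by
    field_simp
    ring
  have h3 : V i 0 = (1 : Matrix (Fin (N + 1)) (Fin (N + 1)) ℍ[ℝ]) i 0
      - (1 - t)⁻¹ • (u i * star (u 0)) := rfl
  rw [h3, hu0, Quaternion.star_coe, Quaternion.mul_coe_eq_smul, smul_smul, h2, hu]
  simp [Matrix.one_apply, Pi.single_apply]

theorem exists_unitary_column_mul {N : ℕ} (v : Fin (N + 1) → ℍ[ℝ]) :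
    ∃ (V : Matrix (Fin (N + 1)) (Fin (N + 1)) ℍ[ℝ]) (q : ℍ[ℝ]),
      V * Vᴴ = 1 ∧ Vᴴ * V = 1 ∧ ∀ i, v i = V i 0 * q := by
  by_cases hv : v = 0
  · exact ⟨1, 0, by simp, by simp, by simp [hv]⟩
  obtain ⟨p, hp, hpv⟩ := exists_mul_eq_neg_norm (v 0)
  have hp' : star p * p = 1 := by rwa [star_comm_self]
  set s : ℝ := ∑ i, Quaternion.normSq (v i) with hs
  have hs0 : 0 < s := by
    obtain ⟨i, hi⟩ := Function.ne_iff.mp hv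
    refine Finset.sum_pos' (fun _ _ ↦ Quaternion.normSq_nonneg) ⟨i, Finset.mem_univ i, ?_⟩
    exact lt_of_le_of_ne Quaternion.normSq_nonneg (Ne.symm (Quaternion.normSq_ne_zero.mpr hi))
  have hr : 0 < √s := Real.sqrt_pos.mpr hs0
  obtain ⟨V, hV1, hV2, hV⟩ := exists_unitary_first_column (fun i ↦ (√s)⁻¹ • (v i * p))
    ((√s)⁻¹ * -‖v 0‖)
    (mul_nonpos_of_nonneg_of_nonpos (by positivity) (by simp))
    (by rw [hpv, Quaternion.smul_coe]) (by
      have hterm (i : Fin (N + 1)) : star ((√s)⁻¹ • (v i * p)) * ((√s)⁻¹ • (v i * p))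
          = ((s⁻¹ * Quaternion.normSq (v i) : ℝ) : ℍ[ℝ]) := by
        rw [Quaternion.star_smul, smul_mul_smul_comm, star_mul, mul_assoc, ← mul_assoc (star (v i)),
          Quaternion.star_mul_self, ← mul_assoc, ← Quaternion.coe_commutes, mul_assoc, hp', mul_one,
          Quaternion.smul_coe, ← mul_inv, Real.mul_self_sqrt hs0.le]
      simp only [hterm]
      rw [← Quaternion.coe_one, ← inv_mul_cancel₀ hs0.ne', hs, Finset.mul_sum]
      exact (map_sum (algebraMap ℝ ℍ[ℝ]) _ _).symm)
  refine ⟨V, √s • star p, hV1, hV2, fun i ↦ ?_⟩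
  rw [hV, smul_mul_smul_comm, inv_mul_cancel₀ hr.ne', one_smul, mul_assoc, hp, mul_one]

/-- The block diagonal matrix `diag(1, W)`. -/
noncomputable def oneBlock {N : ℕ} (W : Matrix (Fin N) (Fin N) ℍ[ℝ]) :
    Matrix (Fin (N + 1)) (Fin (N + 1)) ℍ[ℝ] :=
  Matrix.of (Fin.cons (Fin.cons 1 0) fun i ↦ Fin.cons 0 (W i))

section oneBlock

variable {N : ℕ} (W : Matrix (Fin N) (Fin N) ℍ[ℝ])

@[simp] theorem oneBlock_zero_zero : oneBlock W 0 0 = 1 := rfl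

@[simp] theorem oneBlock_zero_succ (j : Fin N) : oneBlock W 0 j.succ = 0 := rfl

@[simp] theorem oneBlock_succ_zero (i : Fin N) : oneBlock W i.succ 0 = 0 := rfl

@[simp] theorem oneBlock_succ_succ (i j : Fin N) : oneBlock W i.succ j.succ = W i j := rfl

theorem oneBlock_conjTranspose : (oneBlock W)ᴴ = oneBlock Wᴴ := by
  ext1 i j
  refine Fin.cases ?_ (fun i ↦ ?_) i <;> refine Fin.cases ?_ (fun j ↦ ?_) j <;>
    simp [conjTranspose_apply]

theorem oneBlock_mul (W' : Matrix (Fin N) (Fin N) ℍ[ℝ]) :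
    oneBlock W * oneBlock W' = oneBlock (W * W') := by
  ext1 i j
  refine Fin.cases ?_ (fun i ↦ ?_) i <;> refine Fin.cases ?_ (fun j ↦ ?_) j <;>
    simp [mul_apply, Fin.sum_univ_succ]

theorem oneBlock_one : oneBlock (1 : Matrix (Fin N) (Fin N) ℍ[ℝ]) = 1 := by
  ext1 i j
  refine Fin.cases ?_ (fun i ↦ ?_) i <;> refine Fin.cases ?_ (fun j ↦ ?_) j <;>
    simp [one_apply, Fin.succ_ne_zero, (Fin.succ_ne_zero _).symm]

theorem oneBlock_mul_mul_oneBlock_lower (W' : Matrix (Fin N) (Fin N) ℍ[ℝ])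
    (C : Matrix (Fin (N + 1)) (Fin (N + 1)) ℍ[ℝ])
    (hC : ∀ i : Fin N, C i.succ 0 = 0)
    (hB : ∀ j k, k < j → (W * C.submatrix Fin.succ Fin.succ * W') j k = 0) :
    ∀ j k, k < j → (oneBlock W * C * oneBlock W') j k = 0 := by
  intro j k
  refine Fin.cases ?_ (fun j ↦ ?_) j <;> refine Fin.cases ?_ (fun k ↦ ?_) k
  · simp
  · simp
  · simp [mul_apply, Fin.sum_univ_succ, hC]
  · intro h
    have := hB j k (Fin.succ_lt_succ_iff.mp h)
    simpa [mul_apply, Fin.sum_univ_succ] using this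

end oneBlock

/-- If the first column of `C` vanishes below the diagonal, then injectivity of `C` passes to its
lower right block. -/
theorem submatrix_succ_injective {N : ℕ} (C : Matrix (Fin (N + 1)) (Fin (N + 1)) ℍ[ℝ])
    (hC : ∀ i : Fin N, C i.succ 0 = 0) (hinj : ∀ v, C *ᵥ v = 0 → v = 0)
    (w : Fin N → ℍ[ℝ]) (hw : C.submatrix Fin.succ Fin.succ *ᵥ w = 0) : w = 0 := by
  have ha : C 0 0 ≠ 0 := by
    intro ha
    have h := hinj (Pi.single 0 1) (by
      ext1 i
      rw [mulVec_single_one]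
      exact Fin.cases ha hC i)
    simpa using congrFun h 0
  have h := hinj (Fin.cons (-(C 0 0)⁻¹ * ∑ j : Fin N, C 0 j.succ * w j) w) (by
    ext1 i
    refine Fin.cases ?_ (fun i ↦ ?_) i
    · simp [mulVec, dotProduct, Fin.sum_univ_succ, ha]
    · simpa [mulVec, dotProduct, Fin.sum_univ_succ, hC] using congrFun hw i)
  ext1 i
  exact congrFun h i.succ

/-- The orbit of a vector under successive application of the matrices `A 0, A 1, …`, as a linear
map for the right quaternionic structure. -/
noncomputable def orbit {N : ℕ} (A : ℕ → Matrix (Fin N) (Fin N) ℍ[ℝ]) :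
    ℕ → ((Fin N → ℍ[ℝ]) →ₗ[ℍ[ℝ]ᵐᵒᵖ] (Fin N → ℍ[ℝ]))
  | 0 => LinearMap.id
  | k + 1 =>
    { toFun := fun v ↦ A k *ᵥ orbit A k v
      map_add' := fun v w ↦ by rw [map_add, mulVec_add]
      map_smul' := fun q v ↦ by rw [map_smul, mulVec_smul, RingHom.id_apply] }

theorem orbit_succ {N : ℕ} (A : ℕ → Matrix (Fin N) (Fin N) ℍ[ℝ]) (k : ℕ) (v : Fin N → ℍ[ℝ]) :
    orbit A (k + 1) v = A k *ᵥ orbit A k v := rfl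

theorem orbit_ne_zero {N n : ℕ} {A : ℕ → Matrix (Fin N) (Fin N) ℍ[ℝ]}
    (hA : ∀ k < n, ∀ v, A k *ᵥ v = 0 → v = 0) {v : Fin N → ℍ[ℝ]} (hv : v ≠ 0) :
    ∀ k ≤ n, orbit A k v ≠ 0
  | 0, _ => hv
  | k + 1, hk => fun h ↦ orbit_ne_zero hA hv k (by omega) (hA k hk _ h)

/-- There is a cyclic family of unitary matrices bringing the first columns of a cyclic family of
injective matrices to a multiple of the first basis vector. -/
theorem exists_cyclic_unitary_first_column {N n : ℕ}
    (A : ℕ → Matrix (Fin (N + 1)) (Fin (N + 1)) ℍ[ℝ])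
    (hA : ∀ k < n, ∀ v, A k *ᵥ v = 0 → v = 0) :
    ∃ V : ℕ → Matrix (Fin (N + 1)) (Fin (N + 1)) ℍ[ℝ],
      (∀ k, V k * (V k)ᴴ = 1 ∧ (V k)ᴴ * V k = 1) ∧ V n = V 0 ∧
      ∀ k < n, ∀ i : Fin N, ((V (k + 1))ᴴ * A k * V k) i.succ 0 = 0 := by
  obtain ⟨v, hv, l, hl⟩ := exists_right_eigenvector (orbit A n)
  choose H p hH1 hH2 hHp using fun k ↦ exists_unitary_column_mul (orbit A k v)
  let V : ℕ → Matrix (Fin (N + 1)) (Fin (N + 1)) ℍ[ℝ] := fun k ↦ if k = n then H 0 else H k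
  have hVu (k) : V k * (V k)ᴴ = 1 ∧ (V k)ᴴ * V k = 1 := by
    by_cases hk : k = n <;> simp [V, hk, hH1, hH2]
  have hVc (k) : ∃ q, ∀ i, orbit A k v i = V k i 0 * q := by
    by_cases hk : k = n
    · subst hk
      refine ⟨p 0 * l, fun i ↦ ?_⟩
      rw [hl, ← mul_assoc]
      simp only [V, if_true]
      rw [← hHp 0]
      rfl
    · exact ⟨p k, fun i ↦ by simpa [V, hk] using hHp k i⟩
  choose q hq using hVc
  refine ⟨V, hVu, by simp [V], fun k hk i ↦ ?_⟩
  have hqk : q k ≠ 0 := fun h ↦ orbit_ne_zero hA hv k hk.le (by ext1 i; simp [hq, h])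
  have hcol (j) : (A k * V k) j 0 * q k = V (k + 1) j 0 * q (k + 1) := by
    rw [← hq, orbit_succ, mulVec, dotProduct, mul_apply, Finset.sum_mul]
    exact Finset.sum_congr rfl fun m _ ↦ by rw [hq, mul_assoc]
  have hzero : ((V (k + 1))ᴴ * A k * V k) i.succ 0 * q k = 0 := by
    rw [Matrix.mul_assoc, mul_apply, Finset.sum_mul]
    simp only [mul_assoc, hcol]
    simp only [← mul_assoc]
    rw [← Finset.sum_mul, ← mul_apply, (hVu (k + 1)).2, one_apply_ne (Fin.succ_ne_zero i), zero_mul]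
  exact (mul_eq_zero.mp hzero).resolve_right hqk

theorem exists_cyclic_unitary_upper_triangular (n N : ℕ) :
    ∀ A : ℕ → Matrix (Fin N) (Fin N) ℍ[ℝ], (∀ k < n, ∀ v, A k *ᵥ v = 0 → v = 0) →
    ∃ W : ℕ → Matrix (Fin N) (Fin N) ℍ[ℝ],
      (∀ k, W k * (W k)ᴴ = 1 ∧ (W k)ᴴ * W k = 1) ∧ W n = W 0 ∧
      ∀ k < n, ∀ i j, j < i → ((W (k + 1))ᴴ * A k * W k) i j = 0 := by
  induction N with
  | zero => exact fun A _ ↦ ⟨fun _ ↦ 1, by simp, rfl, fun _ _ i ↦ i.elim0⟩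
  | succ N ih =>
    intro A hA
    obtain ⟨V, hVu, hVn, hV⟩ := exists_cyclic_unitary_first_column A hA
    obtain ⟨W, hWu, hWn, hW⟩ :=
      ih (fun k ↦ ((V (k + 1))ᴴ * A k * V k).submatrix Fin.succ Fin.succ) (fun k hk ↦
        submatrix_succ_injective _ (hV k hk) fun v hv ↦ by
          have h1 : V (k + 1) *ᵥ (((V (k + 1))ᴴ * A k * V k) *ᵥ v) = A k *ᵥ (V k *ᵥ v) := by
            rw [mulVec_mulVec, mulVec_mulVec, ← Matrix.mul_assoc, ← Matrix.mul_assoc, (hVu _).1,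
              Matrix.one_mul]
          rw [hv, mulVec_zero] at h1
          have h2 := congrArg ((V k)ᴴ *ᵥ ·) (hA k hk _ h1.symm)
          simpa [mulVec_mulVec, (hVu k).2] using h2)
    refine ⟨fun k ↦ V k * oneBlock (W k), fun k ↦ ⟨?_, ?_⟩, by simp only [hVn, hWn],
      fun k hk ↦ ?_⟩
    · rw [conjTranspose_mul, Matrix.mul_assoc, ← Matrix.mul_assoc (oneBlock _),
        oneBlock_conjTranspose, oneBlock_mul, (hWu k).1, oneBlock_one, Matrix.one_mul, (hVu k).1]
    · rw [conjTranspose_mul, Matrix.mul_assoc, ← Matrix.mul_assoc (V k)ᴴ, (hVu k).2,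
        Matrix.one_mul, oneBlock_conjTranspose, oneBlock_mul, (hWu k).2, oneBlock_one]
    · have := oneBlock_mul_mul_oneBlock_lower _ _ _ (hV k hk) (hW k hk)
      simpa only [conjTranspose_mul, oneBlock_conjTranspose, Matrix.mul_assoc] using this

end QuaternionSchur

/-- Generalised Schur decomposition for quaternion matrices: given invertible `N × N`
quaternion matrices `M_1, …, M_n`, there exist unitary quaternion matrices
`U_1, …, U_n` and upper triangular quaternion matrices `S_1, …, S_n` with
`M_i = U_i S_i U_{i+1}⋆` for `i = 1, …, n`, where `U_{n+1} = U_1`. -/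
theorem quaternion_generalized_schur_decomposition
    (N n : ℕ) (hn : 1 ≤ n)
    (M : ℕ → Matrix (Fin N) (Fin N) (Quaternion ℝ))
    (hM : ∀ i ∈ Finset.Icc 1 n, ∃ Q : Matrix (Fin N) (Fin N) (Quaternion ℝ),
      M i * Q = 1 ∧ Q * M i = 1) :
    ∃ U S : ℕ → Matrix (Fin N) (Fin N) (Quaternion ℝ),
      (∀ i ∈ Finset.Icc 1 n, U i * (U i)ᴴ = 1 ∧ (U i)ᴴ * U i = 1) ∧
      (∀ i ∈ Finset.Icc 1 n, ∀ j k : Fin N, k < j → S i j k = 0) ∧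
      U (n + 1) = U 1 ∧
      (∀ i ∈ Finset.Icc 1 n, M i = U i * S i * (U (i + 1))ᴴ) := by
  obtain ⟨W, hWu, hWn, hW⟩ := QuaternionSchur.exists_cyclic_unitary_upper_triangular n N
    (fun k ↦ M (n - k)) fun k hk v hv ↦ by
      obtain ⟨Q, -, hQ⟩ := hM (n - k) (Finset.mem_Icc.mpr ⟨by omega, by omega⟩)
      have h := congrArg (Q *ᵥ ·) hv
      simpa [mulVec_mulVec, hQ] using h
  refine ⟨fun i ↦ W (n + 1 - i), fun i ↦ (W (n + 1 - i))ᴴ * M i * W (n + 1 - (i + 1)),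
    fun i _ ↦ hWu _, fun i hi j k hjk ↦ ?_, by simp [hWn], fun i _ ↦ ?_⟩
  · obtain ⟨h1, h2⟩ := Finset.mem_Icc.mp hi
    have h := hW (n - i) (by omega) j k hjk
    rwa [show n - (n - i) = i by omega, show n - i + 1 = n + 1 - i by omega,
      show n - i = n + 1 - (i + 1) by omega] at h
  · simp only [Matrix.mul_assoc, (hWu _).1, Matrix.mul_one]
    rw [← Matrix.mul_assoc, (hWu _).1, Matrix.one_mul]
end

section
/- Let n ≥ 1 and let A, B be n × n complex matrices; let M be the 2n × 2n complex block matrix M = [[A, −\bar B],[B, \bar A]], where \bar A and \bar B denote entrywise complex conjugation. Then every coefficient of the characteristic polynomial of M is real; consequently the non-real eigenvalues of M occur in complex-conjugate pairs, i.e. for every λ ∈ ℂ the algebraic multiplicity of λ as a root of the characteristic polynomial of M equals the algebraic multiplicity of \bar λ. Moreover, every real eigenvalue of M has even algebraic multiplicity. -/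
open Matrix

/-- A finite-dimensional complex vector space with an antilinear map squaring to `-1`
(a quaternionic structure) has even dimension. -/
theorem even_finrank_of_quaternionic_structure {V : Type*} [AddCommGroup V] [Module ℂ V]
    [FiniteDimensional ℂ V] (J : V →ₛₗ[starRingEnd ℂ] V) (hJ : ∀ x, J (J x) = -x) :
    Even (Module.finrank ℂ V) := by
  let b := Module.finBasis ℂ V
  let P : Matrix (Fin (Module.finrank ℂ V)) (Fin (Module.finrank ℂ V)) ℂ :=
    Matrix.of fun i j => b.repr (J (b j)) i
  have hP : P * P.map (starRingEnd ℂ) = -1 := by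
    ext k j
    have h : J (J (b j)) = ∑ i, (starRingEnd ℂ) (P i j) • J (b i) := by
      conv_lhs => rw [← b.sum_repr (J (b j)), map_sum]
      simp only [map_smulₛₗ, P, Matrix.of_apply]
    have h' := congrArg (fun v => b.repr v k) ((hJ (b j)).symm.trans h)
    simp only [map_neg, Finsupp.neg_apply, map_sum, map_smul, Finsupp.finsetSum_apply,
      Finsupp.smul_apply, smul_eq_mul, Module.Basis.repr_self] at h'
    rw [Matrix.mul_apply, Matrix.neg_apply, Matrix.one_apply]
    rw [Finsupp.single_apply] at h'
    simp only [eq_comm (a := k), h', Matrix.map_apply, P, Matrix.of_apply, mul_comm]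
  have hdet := congrArg Matrix.det hP
  rw [Matrix.det_mul, ← RingHom.mapMatrix_apply, ← RingHom.map_det, Complex.mul_conj,
    Matrix.det_neg, Matrix.det_one, mul_one, Fintype.card_fin] at hdet
  by_contra hodd
  rw [(Nat.not_even_iff_odd.mp hodd).neg_one_pow] at hdet
  have hre : Complex.normSq P.det = -1 := by exact_mod_cast hdet
  linarith [Complex.normSq_nonneg P.det]

/-- A real eigenvalue of an endomorphism commuting with a quaternionic structure has even algebraic
multiplicity. -/
theorem even_rootMultiplicity_charpoly_of_commute_quaternionic {V : Type*} [AddCommGroup V]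
    [Module ℂ V] [FiniteDimensional ℂ V] (J : V →ₛₗ[starRingEnd ℂ] V) (hJ : ∀ x, J (J x) = -x)
    (f : Module.End ℂ V) (hf : ∀ x, f (J x) = J (f x)) {μ : ℂ} (hμ : (starRingEnd ℂ) μ = μ) :
    Even (f.charpoly.rootMultiplicity μ) := by
  rw [← LinearMap.finrank_maxGenEigenspace_eq]
  have hpow : ∀ (k : ℕ) (x : V),
      ((f - μ • (1 : Module.End ℂ V)) ^ k) (J x) = J (((f - μ • (1 : Module.End ℂ V)) ^ k) x) := by
    intro k
    induction k with
    | zero => simp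
    | succ k ih =>
      intro x
      rw [pow_succ', Module.End.mul_apply, ih, Module.End.mul_apply]
      simp [hf, hμ]
  have hmem : ∀ x ∈ f.maxGenEigenspace μ, J x ∈ f.maxGenEigenspace μ := by
    intro x hx
    obtain ⟨k, hk⟩ := (Module.End.mem_maxGenEigenspace f μ x).mp hx
    exact (Module.End.mem_maxGenEigenspace f μ _).mpr ⟨k, by rw [hpow, hk, map_zero]⟩
  let J' : f.maxGenEigenspace μ →ₛₗ[starRingEnd ℂ] f.maxGenEigenspace μ :=
    { toFun := fun x => ⟨J x, hmem x x.2⟩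
      map_add' := fun x y => Subtype.ext (by simp)
      map_smul' := fun c x => Subtype.ext (by simp) }
  exact even_finrank_of_quaternionic_structure J' fun x => Subtype.ext (hJ x)

/-- The antilinear map `(x, y) ↦ (-ȳ, x̄)`, right multiplication by the quaternion unit `j`. -/
noncomputable def quaternionicStructure (n : Type*) :
    (n ⊕ n → ℂ) →ₛₗ[starRingEnd ℂ] (n ⊕ n → ℂ) where
  toFun x := Sum.elim (fun i => -(starRingEnd ℂ) (x (Sum.inr i)))
    (fun i => (starRingEnd ℂ) (x (Sum.inl i)))
  map_add' x y := by
    ext i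
    rcases i with i | i <;> simp [add_comm]
  map_smul' c x := by
    ext i
    rcases i with i | i <;> simp

theorem quaternionicStructure_apply_apply {n : Type*} (x : n ⊕ n → ℂ) :
    quaternionicStructure n (quaternionicStructure n x) = -x := by
  ext i
  rcases i with i | i <;> simp [quaternionicStructure]

theorem fromBlocks_conj_mulVec_quaternionicStructure {n : Type*} [Fintype n] (A B : Matrix n n ℂ)
    (x : n ⊕ n → ℂ) :
    Matrix.fromBlocks A (-(B.map (starRingEnd ℂ))) B (A.map (starRingEnd ℂ)) *ᵥ
        quaternionicStructure n x =
      quaternionicStructure n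
        (Matrix.fromBlocks A (-(B.map (starRingEnd ℂ))) B (A.map (starRingEnd ℂ)) *ᵥ x) := by
  ext i
  rcases i with i | i
  · simp [quaternionicStructure, Matrix.mulVec, dotProduct]
  · simp [quaternionicStructure, Matrix.mulVec, dotProduct]
    ring

/-- The characteristic polynomial of `[[A, -B̄], [B, Ā]]` is invariant under conjugation. -/
theorem charpoly_fromBlocks_conj_map {n : Type*} [Fintype n] [DecidableEq n]
    (A B : Matrix n n ℂ) :
    (Matrix.fromBlocks A (-(B.map (starRingEnd ℂ))) B (A.map (starRingEnd ℂ))).charpoly.map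
        (starRingEnd ℂ) =
      (Matrix.fromBlocks A (-(B.map (starRingEnd ℂ))) B (A.map (starRingEnd ℂ))).charpoly := by
  set M := Matrix.fromBlocks A (-(B.map (starRingEnd ℂ))) B (A.map (starRingEnd ℂ)) with hM
  have hconj : M.map (starRingEnd ℂ) =
      Matrix.fromBlocks 0 1 (-1) 0 * (M * Matrix.fromBlocks 0 (-1) 1 0) := by
    rw [hM, Matrix.fromBlocks_multiply, Matrix.fromBlocks_multiply, Matrix.fromBlocks_map]
    congr 1 <;> ext i j <;> simp
  rw [← Matrix.charpoly_map, hconj, Matrix.charpoly_mul_comm, Matrix.mul_assoc,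
    Matrix.fromBlocks_multiply]
  simp

/-- For the complex `2n × 2n` block representation `M = [[A, -B̄],[B, Ā]]` of an
`n × n` quaternion matrix, the characteristic polynomial has real coefficients;
consequently the multiplicity of any `λ` as a root equals the multiplicity of `λ̄`
(non-real eigenvalues come in conjugate pairs), and every real eigenvalue has even
algebraic multiplicity. -/
theorem quaternion_block_matrix_charpoly_real
    (n : ℕ) (hn : 1 ≤ n) (A B : Matrix (Fin n) (Fin n) ℂ)
    (M : Matrix (Fin n ⊕ Fin n) (Fin n ⊕ Fin n) ℂ)
    (hM : M = Matrix.fromBlocks A (-(B.map (starRingEnd ℂ))) B (A.map (starRingEnd ℂ))) :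
    (∀ k : ℕ, (M.charpoly.coeff k).im = 0) ∧
    (∀ lam : ℂ,
      M.charpoly.rootMultiplicity lam = M.charpoly.rootMultiplicity ((starRingEnd ℂ) lam)) ∧
    (∀ lam : ℂ, lam.im = 0 → Even (M.charpoly.rootMultiplicity lam)) := by
  subst hM
  have hmap := charpoly_fromBlocks_conj_map A B
  refine ⟨fun k => ?_, fun lam => ?_, fun lam hlam => ?_⟩
  · rw [← Complex.conj_eq_iff_im, ← Polynomial.coeff_map, hmap]
  · rw [Polynomial.eq_rootMultiplicity_map (starRingEnd ℂ).injective, hmap]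
  · rw [← Matrix.charpoly_toLin']
    exact even_rootMultiplicity_charpoly_of_commute_quaternionic (quaternionicStructure (Fin n))
      quaternionicStructure_apply_apply _
      (fun x => by
        simpa only [Matrix.toLin'_apply] using fromBlocks_conj_mulVec_quaternionicStructure A B x)
      (Complex.conj_eq_iff_im.mpr hlam)
end
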